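/- In the i.i.d. two-group model, the lfdr-ranked rule dominates any measurable decision rule: let δ : ℝ^m → {0,1}^m be any measurable (multiple testing) decision rule, and define δ* : ℝ^m → {0,1}^m by letting δ*(z) reject exactly the k(z) := Σ_i δ_i(z) hypotheses whose indices have the smallest values of lfdr(z_i) (ties broken by taking the smallest index). Then δ* satisfies P(FDP(δ*(Z), θ) > γ) ≤ P(FDP(δ(Z), θ) > γ) for every γ ∈ [0,1), and E[Σ_i θ_i δ*_i(Z)] ≥ E[Σ_i θ_i δ_i(Z)]. In particular, for any FDX level (γ, α), if δ satisfies P(FDP(δ(Z), θ) > γ) ≤ α then so does δ*, and δ* has at least as large an expected number of true positives. -/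

import Mathlib

open MeasureTheory ProbabilityTheory Finset

/-- Numeric value of a `{0,1}`-valued (Boolean) variable. -/
def bval (b : Bool) : ℝ := if b then 1 else 0

/-- The false discovery proportion of a decision vector `d` against states `t`:
`FDP(d, t) = (Σᵢ (1−tᵢ)dᵢ) / max(Σᵢ dᵢ, 1)`. -/
noncomputable def FDP {m : ℕ} (d t : Fin m → Bool) : ℝ :=
  (∑ i, (1 - bval (t i)) * bval (d i)) / max (∑ i, bval (d i)) 1

open Classical in
/-- The lfdr-ranked rule `δ*` induced by a rule `δ`: at data `z`, it rejects exactly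
`k(z) = Σᵢ δᵢ(z)` hypotheses, namely those indices with the smallest values of
`lfdr(zᵢ)`, ties broken by taking the smallest index.  (Index `i` is rejected iff
fewer than `k(z)` indices strictly precede it in the tie-broken lfdr order.) -/
noncomputable def deltaStar {m : ℕ} (lfdr : ℝ → ℝ) (δ : (Fin m → ℝ) → Fin m → Bool)
    (z : Fin m → ℝ) (i : Fin m) : Bool :=
  decide ((Finset.univ.filter fun j : Fin m =>
      lfdr (z j) < lfdr (z i) ∨ (lfdr (z j) = lfdr (z i) ∧ j < i)).card
    < (Finset.univ.filter fun j : Fin m => δ z j = true).card)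

section ExchangeArgument

variable {ι : Type*} [DecidableEq ι]

theorem comp_swap_comp_swap {β : Type*} (t : ι → β) (i j : ι) :
    (t ∘ Equiv.swap i j) ∘ Equiv.swap i j = t := by
  ext l
  simp

theorem comp_swap_of_eq {β : Type*} (t : ι → β) {i j : ι} (h : t i = t j) :
    t ∘ Equiv.swap i j = t := by
  ext l
  rcases eq_or_ne l i with rfl | hi
  · simp [h]
  rcases eq_or_ne l j with rfl | hj
  · simp [h]
  simp [Equiv.swap_apply_of_ne_of_ne hi hj]

variable [Fintype ι]

/-- Moving a success from `i` to `j` decreases a product weight whose odds are larger at `j`. -/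
theorem prod_weight_comp_swap_le {a b : ι → ℝ} (ha : ∀ l, 0 ≤ a l) (hb : ∀ l, 0 ≤ b l)
    {i j : ι} (hij : i ≠ j) (hodds : a i * b j ≤ a j * b i) {t : ι → Bool}
    (hi : t i = false) (hj : t j = true) :
    ∏ l, (if (t ∘ Equiv.swap i j) l then a l else b l) ≤ ∏ l, (if t l then a l else b l) := by
  have split (f : ι → ℝ) : ∏ l, f l = f i * (f j * ∏ l ∈ (univ.erase i).erase j, f l) := by
    rw [mul_prod_erase _ _ (by simp [hij.symm]), mul_prod_erase _ _ (mem_univ i)]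
  rw [split, split]
  have hrest : ∏ l ∈ (univ.erase i).erase j, (if (t ∘ Equiv.swap i j) l then a l else b l) =
      ∏ l ∈ (univ.erase i).erase j, (if t l then a l else b l) := by
    refine prod_congr rfl fun l hl => ?_
    simp only [mem_erase, mem_univ, and_true] at hl
    simp [Equiv.swap_apply_of_ne_of_ne hl.2 hl.1]
  have hnonneg : 0 ≤ ∏ l ∈ (univ.erase i).erase j, (if t l then a l else b l) :=
    prod_nonneg fun l _ => by split_ifs <;> simp [ha, hb]
  rw [hrest]
  simp only [Function.comp_apply, Equiv.swap_apply_left, Equiv.swap_apply_right, hi, hj]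
  simp only [if_true, Bool.false_eq_true, if_false]
  nlinarith [mul_le_mul_of_nonneg_right hodds hnonneg]

variable {G : (ι → Bool) → (ι → Bool) → ℝ}

/-- A single exchange of a rejected `i` for an unrejected `j` with larger odds increases the
posterior expectation of a payoff `G d t` that is monotone in the states of the rejections. -/
theorem sum_payoff_le_sum_payoff_comp_swap {a b : ι → ℝ}
    (ha : ∀ l, 0 ≤ a l) (hb : ∀ l, 0 ≤ b l)
    (hperm : ∀ (σ : Equiv.Perm ι) d t, G (d ∘ σ) (t ∘ σ) = G d t)
    (hmono : ∀ d t t', (∀ l, d l = true → t l = true → t' l = true) → G d t ≤ G d t')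
    {d : ι → Bool} {i j : ι} (hi : d i = true) (hj : d j = false)
    (hodds : a i * b j ≤ a j * b i) :
    ∑ t, G d t * ∏ l, (if t l then a l else b l) ≤
      ∑ t, G (d ∘ Equiv.swap i j) t * ∏ l, (if t l then a l else b l) := by
  have hij : i ≠ j := by rintro rfl; simp [hi] at hj
  set w : (ι → Bool) → ℝ := fun t => ∏ l, (if t l then a l else b l) with hw
  let s : Equiv.Perm (ι → Bool) :=
    Function.Involutive.toPerm (fun t => t ∘ Equiv.swap i j) (fun t => comp_swap_comp_swap t i j)
  have hs (t) : s t = t ∘ Equiv.swap i j := rfl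
  have hss (t) : s (s t) = t := comp_swap_comp_swap t i j
  have hGs (t) : G (d ∘ Equiv.swap i j) t = G d (s t) := by
    rw [← hperm (Equiv.swap i j) d (s t), hs, comp_swap_comp_swap]
  have key (t : ι → Bool) (hti : t i = false) (htj : t j = true) :
      G d t ≤ G d (s t) ∧ w (s t) ≤ w t := by
    refine ⟨hmono _ _ _ fun l hdl htl => ?_,
      prod_weight_comp_swap_le ha hb hij hodds hti htj⟩
    rcases eq_or_ne l i with rfl | hli
    · simp [hs, htj]
    rcases eq_or_ne l j with rfl | hlj
    · simp [hj] at hdl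
    simpa [hs, Equiv.swap_apply_of_ne_of_ne hli hlj] using htl
  have hterm (t : ι → Bool) : 0 ≤ (G d (s t) - G d t) * (w t - w (s t)) := by
    cases hti : t i <;> cases htj : t j
    · simp [hs, comp_swap_of_eq t (hti.trans htj.symm)]
    · have := key t hti htj
      exact mul_nonneg (by linarith) (by linarith)
    · have := key (s t) (by simp [hs, htj]) (by simp [hs, hti])
      rw [hss] at this
      exact mul_nonneg_of_nonpos_of_nonpos (by linarith) (by linarith)
    · simp [hs, comp_swap_of_eq t (hti.trans htj.symm)]
  have h1 : ∑ t, G d (s t) * w (s t) = ∑ t, G d t * w t :=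
    Equiv.sum_comp s fun t => G d t * w t
  have h2 : ∑ t, G d t * w (s t) = ∑ t, G d (s t) * w t := by
    rw [← Equiv.sum_comp s]
    simp only [hss]
  have h3 := sum_nonneg fun t (_ : t ∈ (univ : Finset (ι → Bool))) => hterm t
  simp only [sub_mul, mul_sub, sum_sub_distrib, h1, h2] at h3
  simp only [hGs]
  linarith

/-- Among decisions with a given number of rejections, one rejecting the hypotheses of largest
odds maximizes the posterior expectation of a monotone payoff. -/
theorem sum_payoff_le_of_odds_le {a b : ι → ℝ}
    (ha : ∀ l, 0 ≤ a l) (hb : ∀ l, 0 ≤ b l)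
    (hperm : ∀ (σ : Equiv.Perm ι) d t, G (d ∘ σ) (t ∘ σ) = G d t)
    (hmono : ∀ d t t', (∀ l, d l = true → t l = true → t' l = true) → G d t ≤ G d t')
    {e : ι → Bool}
    (hodds : ∀ i j, e i = false → e j = true → a i * b j ≤ a j * b i) (d : ι → Bool)
    (hcard : #{i | d i = true} = #{i | e i = true}) :
    ∑ t, G d t * ∏ l, (if t l then a l else b l) ≤
      ∑ t, G e t * ∏ l, (if t l then a l else b l) := by
  induction hn : #(({i | d i = true} : Finset ι) \ ({i | e i = true} : Finset ι)) using Nat.strong_induction_on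
    generalizing d with
  | _ n ih =>
  rcases (({i | d i = true} : Finset ι) \ ({i | e i = true} : Finset ι)).eq_empty_or_nonempty with h0 | ⟨i, hi⟩
  · have hsub := eq_of_subset_of_card_le (sdiff_eq_empty_iff_subset.mp h0) hcard.ge
    have hde : d = e := by
      ext l
      have := Finset.ext_iff.mp hsub l
      simpa using Bool.eq_iff_iff.mpr (by simpa using this)
    rw [hde]
  · obtain ⟨j, hj⟩ : (({i | e i = true} : Finset ι) \ ({i | d i = true} : Finset ι)).Nonempty := by
      rw [← card_pos, card_sdiff_comm hcard.symm, card_pos]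
      exact ⟨i, hi⟩
    have hi' : d i = true ∧ e i = false := by simpa using hi
    have hj' : e j = true ∧ d j = false := by simpa using hj
    refine (sum_payoff_le_sum_payoff_comp_swap ha hb hperm hmono hi'.1 hj'.2
      (hodds i j hi'.2 hj'.1)).trans (ih _ ?_ _ ?_ rfl)
    · rw [← hn]
      refine card_lt_card ((ssubset_iff_of_subset fun l hl => ?_).mpr ⟨i, hi, ?_⟩)
      · rcases eq_or_ne l i with rfl | hli
        · simp [hj'.2] at hl
        rcases eq_or_ne l j with rfl | hlj
        · simp [hj'.1] at hl
        simpa [Equiv.swap_apply_of_ne_of_ne hli hlj] using hl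
      · simp [hj'.2]
    · rw [← hcard]
      refine card_equiv (Equiv.swap i j) fun l => by simp

end ExchangeArgument

section Ranking

/-- In a finite linear order, exactly `k` elements have fewer than `k` predecessors. -/
theorem card_filter_card_lt_lt {ι β : Type*} [Fintype ι] [LinearOrder β] {f : ι → β}
    (hf : Function.Injective f) {k : ℕ} (hk : k ≤ Fintype.card ι) :
    #{i | #{j | f j < f i} < k} = k := by
  classical
  set r : ι → ℕ := fun i => #{j | f j < f i} with hr
  have hmono {i i' : ι} (h : f i < f i') : r i < r i' := by
    refine card_lt_card ((ssubset_iff_of_subset fun l hl => ?_).mpr ⟨i, by simpa using h, by simp⟩)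
    simp only [mem_filter, mem_univ, true_and] at hl ⊢
    exact hl.trans h
  have hinj : Function.Injective r := fun i i' h => by
    rcases lt_trichotomy (f i) (f i') with hl | he | hg
    · exact absurd h (hmono hl).ne
    · exact hf he
    · exact absurd h (hmono hg).ne'
  have hlt (i : ι) : r i < Fintype.card ι :=
    card_lt_univ_of_notMem (x := i) (by simp)
  have himg : univ.image r = range (Fintype.card ι) := by
    refine eq_of_subset_of_card_le (fun x hx => ?_) ?_
    · obtain ⟨i, -, rfl⟩ := mem_image.mp hx
      exact mem_range.mpr (hlt i)
    · rw [card_image_of_injective _ hinj, card_range, card_univ]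
  rw [← card_image_of_injective _ hinj]
  conv_rhs => rw [← card_range k]
  congr 1
  ext x
  simp only [mem_image, mem_filter, mem_univ, true_and, mem_range]
  constructor
  · rintro ⟨i, hi, rfl⟩
    exact hi
  · intro hx
    have : x ∈ univ.image r := by
      rw [himg, mem_range]
      omega
    obtain ⟨i, -, rfl⟩ := mem_image.mp this
    exact ⟨i, hx, rfl⟩

variable {m : ℕ} {lfdr : ℝ → ℝ} {δ : (Fin m → ℝ) → Fin m → Bool}

theorem deltaStar_eq_true_iff {z : Fin m → ℝ} {i : Fin m} :
    deltaStar lfdr δ z i = true ↔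
      #{j | toLex (lfdr (z j), j) < toLex (lfdr (z i), i)} < #{j | δ z j = true} := by
  simp [deltaStar, Prod.Lex.toLex_lt_toLex]

theorem card_deltaStar (z : Fin m → ℝ) :
    #{i | deltaStar lfdr δ z i = true} = #{i | δ z i = true} := by
  simp only [deltaStar_eq_true_iff]
  exact card_filter_card_lt_lt (f := fun i => toLex (lfdr (z i), i))
    (fun i j h => (Prod.ext_iff.mp (toLex.injective h)).2) (card_le_univ _)

theorem lfdr_le_of_deltaStar {z : Fin m → ℝ} {i j : Fin m}
    (hi : deltaStar lfdr δ z i = false) (hj : deltaStar lfdr δ z j = true) :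
    lfdr (z j) ≤ lfdr (z i) := by
  by_contra! h
  have hij : toLex (lfdr (z i), i) < toLex (lfdr (z j), j) :=
    Prod.Lex.toLex_lt_toLex.mpr (Or.inl h)
  refine absurd ?_ (Bool.eq_false_iff.mp hi)
  rw [deltaStar_eq_true_iff] at hj ⊢
  refine (card_le_card fun l hl => ?_).trans_lt hj
  simp only [mem_filter, mem_univ, true_and] at hl ⊢
  exact hl.trans hij

theorem measurable_deltaStar (hlfdr : Measurable lfdr) (hδ : Measurable δ) :
    Measurable (deltaStar lfdr δ) := by
  classical
  refine measurable_pi_lambda _ fun i => ?_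
  unfold deltaStar
  have hl (j : Fin m) : Measurable fun z : Fin m → ℝ => lfdr (z j) :=
    hlfdr.comp (measurable_pi_apply j)
  have hδj (j : Fin m) : MeasurableSet {z | δ z j = true} :=
    ((measurable_pi_apply j).comp hδ) (measurableSet_singleton true)
  refine measurable_to_bool ?_
  simp only [Set.preimage, Set.mem_singleton_iff, decide_eq_true_eq]
  refine measurableSet_lt ?_ ?_
  · simp only [card_filter]
    refine Finset.measurable_sum _ fun j _ => Measurable.ite ?_ measurable_const measurable_const
    exact (measurableSet_lt (hl j) (hl i)).union
      ((measurableSet_eq_fun (hl j) (hl i)).inter (MeasurableSet.const _))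
  · simp only [card_filter]
    exact Finset.measurable_sum _ fun j _ =>
      Measurable.ite (hδj j) measurable_const measurable_const

end Ranking

section Payoff

variable {m : ℕ}

theorem FDP_comp_perm (σ : Equiv.Perm (Fin m)) (d t : Fin m → Bool) :
    FDP (d ∘ σ) (t ∘ σ) = FDP d t := by
  simp only [FDP, Function.comp_apply]
  rw [Equiv.sum_comp σ fun i => (1 - bval (t i)) * bval (d i),
    Equiv.sum_comp σ fun i => bval (d i)]

theorem FDP_le_FDP {d t t' : Fin m → Bool}
    (h : ∀ l, d l = true → t l = true → t' l = true) : FDP d t' ≤ FDP d t := by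
  refine div_le_div_of_nonneg_right (sum_le_sum fun l _ => ?_) (by positivity)
  specialize h l
  cases hd : d l <;> cases ht : t l <;> cases ht' : t' l <;> simp_all [bval]

end Payoff

/-- The expectation of a function of the decisions and states as an integral of its unnormalized
posterior expectation. -/
theorem integral_comp_eq_integral_sum_mul {Ω X T D : Type*} [MeasurableSpace Ω]
    [MeasurableSpace X] [Fintype T] [MeasurableSpace T] [MeasurableSingletonClass T]
    [Fintype D] [MeasurableSpace D] [MeasurableSingletonClass D]
    {P : Measure Ω} [IsProbabilityMeasure P] {μ : Measure X}
    {θ : Ω → T} {Z : Ω → X} (hθ : Measurable θ) (hZ : Measurable Z)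
    {p : T → X → ℝ} (hp : ∀ t, Integrable (p t) μ)
    (hmodel : ∀ t A, MeasurableSet A → P.real {ω | θ ω = t ∧ Z ω ∈ A} = ∫ z in A, p t z ∂μ)
    {d : X → D} (hd : Measurable d) (G : D → T → ℝ) :
    Integrable (fun z => ∑ t, G (d z) t * p t z) μ ∧
      ∫ ω, G (d (Z ω)) (θ ω) ∂P = ∫ z, ∑ t, G (d z) t * p t z ∂μ := by
  classical
  have hset (e : D) : MeasurableSet {z | d z = e} := hd (measurableSet_singleton e)
  have hdecomp (t : T) (z : X) : G (d z) t * p t z =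
      ∑ e, G e t * Set.indicator {z | d z = e} (p t) z := by
    simp [Set.indicator_apply]
  have hint (t : T) (e : D) :
      Integrable (fun z => G e t * Set.indicator {z | d z = e} (p t) z) μ :=
    ((hp t).indicator (hset e)).const_mul _
  simp only [hdecomp]
  refine ⟨integrable_finsetSum _ fun t _ => integrable_finsetSum _ fun e _ => hint t e, ?_⟩
  rw [integral_finsetSum _ fun t _ => integrable_finsetSum _ fun e _ => hint t e]
  simp only [integral_finsetSum _ fun e _ => hint _ e, integral_const_mul,
    integral_indicator (hset _)]
  have hY : Measurable fun ω => (θ ω, d (Z ω)) := hθ.prodMk (hd.comp hZ)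
  have hmap := integral_map (f := fun y : T × D => G y.2 y.1) (μ := P) hY.aemeasurable
    (measurable_of_finite _).aestronglyMeasurable
  have := Measure.isProbabilityMeasure_map (μ := P) hY.aemeasurable
  rw [← hmap, integral_fintype (Integrable.of_finite), Fintype.sum_prod_type]
  refine sum_congr rfl fun t _ => sum_congr rfl fun e _ => ?_
  rw [map_measureReal_apply hY (measurableSet_singleton _), smul_eq_mul, mul_comm,
    ← hmodel t _ (hset e)]
  congr 2
  ext ω
  simp

/-- **Optimality of the lfdr ranking in the i.i.d. two-group model**: for any measurable
decision rule `δ`, the lfdr-ranked rule `δ*` rejecting the same number of hypotheses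
satisfies `P(FDP(δ*) > γ) ≤ P(FDP(δ) > γ)` for every `γ ∈ [0,1)` and
`E[Σᵢ θᵢ δ*ᵢ] ≥ E[Σᵢ θᵢ δᵢ]`; in particular, if `δ` controls the FDX at level
`(γ, α)` then so does `δ*`, with at least as large an expected number of true
positives. -/
theorem lfdr_ranking_optimal {Ω : Type*} [MeasureSpace Ω]
    [IsProbabilityMeasure (ℙ : Measure Ω)]
    (m : ℕ) (π : ℝ) (hπ : π ∈ Set.Ioo (0 : ℝ) 1)
    (f0 f1 : ℝ → ℝ) (hf0m : Measurable f0) (hf1m : Measurable f1)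
    (hf0nonneg : ∀ z, 0 ≤ f0 z) (hf1nonneg : ∀ z, 0 ≤ f1 z)
    (hf0int : ∫ z, f0 z = 1) (hf1int : ∫ z, f1 z = 1)
    (hfpos : ∀ z, 0 < (1 - π) * f0 z + π * f1 z)
    (θ : Ω → Fin m → Bool) (Z : Ω → Fin m → ℝ)
    (hθ : Measurable θ) (hZ : Measurable Z)
    -- the two-group model: the `θᵢ` are i.i.d. Bernoulli(π) and, given `θ`, the `Zᵢ`
    -- are independent with density `f0` under the null and `f1` under the alternative
    (hmodel : ∀ (t : Fin m → Bool) (A : Set (Fin m → ℝ)), MeasurableSet A →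
      (ℙ {ω | θ ω = t ∧ Z ω ∈ A}).toReal =
        ∫ z in A, ∏ i, (if t i then π * f1 (z i) else (1 - π) * f0 (z i)))
    (δ : (Fin m → ℝ) → Fin m → Bool) (hδ : Measurable δ)
    (lfdr : ℝ → ℝ)
    (hlfdr : ∀ z, lfdr z = (1 - π) * f0 z / ((1 - π) * f0 z + π * f1 z)) :
    (∀ γ ∈ Set.Ico (0 : ℝ) 1,
      ℙ {ω | FDP (deltaStar lfdr δ (Z ω)) (θ ω) > γ} ≤
        ℙ {ω | FDP (δ (Z ω)) (θ ω) > γ}) ∧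
    ((∫ ω, ∑ i, bval (θ ω i) * bval (deltaStar lfdr δ (Z ω) i)) ≥
        ∫ ω, ∑ i, bval (θ ω i) * bval (δ (Z ω) i)) ∧
    (∀ γ ∈ Set.Ico (0 : ℝ) 1, ∀ α : ℝ,
      ℙ {ω | FDP (δ (Z ω)) (θ ω) > γ} ≤ ENNReal.ofReal α →
        ℙ {ω | FDP (deltaStar lfdr δ (Z ω)) (θ ω) > γ} ≤ ENNReal.ofReal α) := by
  obtain ⟨hπ0, hπ1⟩ := hπ
  have hlm : Measurable lfdr := by
    rw [funext hlfdr]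
    fun_prop
  have hδs := measurable_deltaStar hlm hδ
  have hf0i : Integrable f0 := .of_integral_ne_zero (by simp [hf0int])
  have hf1i : Integrable f1 := .of_integral_ne_zero (by simp [hf1int])
  have ha (z : ℝ) : 0 ≤ π * f1 z := mul_nonneg hπ0.le (hf1nonneg z)
  have hb (z : ℝ) : 0 ≤ (1 - π) * f0 z := mul_nonneg (by linarith) (hf0nonneg z)
  have hp (t : Fin m → Bool) : Integrable fun z : Fin m → ℝ =>
      ∏ i, (if t i then π * f1 (z i) else (1 - π) * f0 (z i)) := by
    refine Integrable.fintype_prod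
      (f := fun i x => if t i then π * f1 x else (1 - π) * f0 x) fun i => ?_
    cases t i
    · simpa using hf0i.const_mul (1 - π)
    · simpa using hf1i.const_mul π
  have hodds {x y : ℝ} (h : lfdr y ≤ lfdr x) :
      π * f1 x * ((1 - π) * f0 y) ≤ π * f1 y * ((1 - π) * f0 x) := by
    rw [hlfdr, hlfdr, div_le_div_iff₀ (hfpos y) (hfpos x)] at h
    linarith
  have main (G : (Fin m → Bool) → (Fin m → Bool) → ℝ)
      (hperm : ∀ (σ : Equiv.Perm (Fin m)) d t, G (d ∘ σ) (t ∘ σ) = G d t)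
      (hmono : ∀ d t t', (∀ l, d l = true → t l = true → t' l = true) → G d t ≤ G d t') :
      ∫ ω, G (δ (Z ω)) (θ ω) ≤ ∫ ω, G (deltaStar lfdr δ (Z ω)) (θ ω) := by
    obtain ⟨hi, he⟩ := integral_comp_eq_integral_sum_mul hθ hZ hp hmodel hδ G
    obtain ⟨his, hes⟩ := integral_comp_eq_integral_sum_mul hθ hZ hp hmodel hδs G
    rw [he, hes]
    refine integral_mono hi his fun z => ?_
    exact sum_payoff_le_of_odds_le (fun l => ha (z l)) (fun l => hb (z l)) hperm hmono
      (fun i j hi hj => hodds (lfdr_le_of_deltaStar hi hj)) _ (card_deltaStar z).symm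
  have hFDX (γ : ℝ) : ℙ {ω | FDP (deltaStar lfdr δ (Z ω)) (θ ω) > γ} ≤
      ℙ {ω | FDP (δ (Z ω)) (θ ω) > γ} := by
    have hprob {d : (Fin m → ℝ) → Fin m → Bool} (hd : Measurable d) :
        ∫ ω, (-if FDP (d (Z ω)) (θ ω) > γ then (1 : ℝ) else 0) =
          -(ℙ : Measure Ω).real {ω | FDP (d (Z ω)) (θ ω) > γ} := by
      have hset : MeasurableSet {ω | FDP (d (Z ω)) (θ ω) > γ} :=
        ((hd.comp hZ).prodMk hθ)
          (Set.toFinite {y : (Fin m → Bool) × (Fin m → Bool) | FDP y.1 y.2 > γ}).measurableSet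
      rw [integral_neg, ← integral_indicator_one hset]
      rfl
    have := main (fun d t => -if FDP d t > γ then 1 else 0)
      (fun σ d t => by simp only [FDP_comp_perm]) (fun d t t' h => by
        have := FDP_le_FDP h
        split_ifs <;> linarith)
    rw [hprob hδ, hprob hδs, neg_le_neg_iff] at this
    exact (ENNReal.toReal_le_toReal (measure_ne_top _ _) (measure_ne_top _ _)).mp this
  refine ⟨fun γ _ => hFDX γ, ?_, fun γ _ α h => (hFDX γ).trans h⟩
  refine main (fun d t => ∑ i, bval (t i) * bval (d i))
    (fun σ d t => Equiv.sum_comp σ fun i => bval (t i) * bval (d i))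
    (fun d t t' h => sum_le_sum fun l _ => ?_)
  specialize h l
  cases hd : d l <;> cases ht : t l <;> cases ht' : t' l <;> simp_all [bval]
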